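/- Let {S_i}_{i∈I} be an inverse system of spectral spaces over a directed partially ordered set I, with quasi-compact surjective transition maps, and let S = lim_i S_i. Suppose in addition that each S_i is a disjoint union of finitely many irreducible spaces, i.e. each S_i admits a finite partition into pairwise disjoint open irreducible subspaces. Then for every dense quasi-compact open subset U ⊆ S, the natural map π₀(U) → π₀(S) induced by the inclusion U ⊆ S is a homeomorphism. -/

import Mathlib

/-- A topological space is *spectral* if it is quasi-compact, T0, sober, and the
quasi-compact open subsets are stable under finite intersections and form a basis. -/
def IsSpectralSpace (X : Type*) [TopologicalSpace X] : Prop :=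
  CompactSpace X ∧ T0Space X ∧ QuasiSober X ∧
    (∀ U V : Set X, IsOpen U → IsCompact U → IsOpen V → IsCompact V → IsCompact (U ∩ V)) ∧
    TopologicalSpace.IsTopologicalBasis {U : Set X | IsOpen U ∧ IsCompact U}

open Topology TopologicalSpace

section QuasiComponents

variable {X : Type*} [TopologicalSpace X]

/-- A compact set disjoint from the quasi-component of `x` is disjoint from some clopen
neighbourhood of `x`. -/
lemma IsCompact.exists_isClopen_disjoint_of_disjoint_iInter {K : Set X} (hK : IsCompact K) (x : X)
    (h : ∀ y ∈ K, ∃ D : Set X, IsClopen D ∧ x ∈ D ∧ y ∉ D) :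
    ∃ D : Set X, IsClopen D ∧ x ∈ D ∧ Disjoint K D := by
  refine hK.induction_on (p := fun K ↦ ∃ D : Set X, IsClopen D ∧ x ∈ D ∧ Disjoint K D)
    ⟨Set.univ, isClopen_univ, trivial, by simp⟩ ?_ ?_ ?_
  · rintro s t hst ⟨D, hD, hx, hdis⟩
    exact ⟨D, hD, hx, hdis.mono_left hst⟩
  · rintro s t ⟨D, hD, hx, hs⟩ ⟨E, hE, hx', ht⟩
    exact ⟨D ∩ E, hD.inter hE, ⟨hx, hx'⟩, Set.disjoint_union_left.2
      ⟨hs.mono_right Set.inter_subset_left, ht.mono_right Set.inter_subset_right⟩⟩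
  · intro y hy
    obtain ⟨D, hD, hx, hyD⟩ := h y hy
    exact ⟨Dᶜ, mem_nhdsWithin_of_mem_nhds (hD.compl.isOpen.mem_nhds hyD), D, hD, hx,
      disjoint_compl_left⟩

variable [CompactSpace X] [PrespectralSpace X] [QuasiSeparatedSpace X]

/-- In a compact, quasi-separated space with a basis of compact opens, two points which are not
separated by a clopen set lie in the same connected component. -/
lemma PrespectralSpace.mem_connectedComponent_of_forall_isClopen {x y : X}
    (h : ∀ D : Set X, IsClopen D → x ∈ D → y ∈ D) : y ∈ connectedComponent x := by
  let Q : Set X := ⋂ D : {D : Set X // IsClopen D ∧ x ∈ D}, D.1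
  have hQ_mem {z : X} : z ∈ Q ↔ ∀ D : Set X, IsClopen D → x ∈ D → z ∈ D := by
    simp [Q]
  have hQ_closed : IsClosed Q := isClosed_iInter fun D ↦ D.2.1.isClosed
  have hxQ : x ∈ Q := hQ_mem.2 fun D _ hx ↦ hx
  suffices hQ : IsPreconnected Q from hQ.subset_connectedComponent hxQ (hQ_mem.2 h)
  rw [isPreconnected_iff_subset_of_disjoint]
  intro u v hu hv huv hdis
  have hdis' : ∀ z ∈ Q, z ∈ u → z ∉ v := fun z hz hzu hzv ↦
    (hdis ▸ (⟨hz, hzu, hzv⟩ : z ∈ Q ∩ (u ∩ v)) : z ∈ (∅ : Set X))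
  obtain ⟨A, hAc, hAo, hQA, hAu⟩ := PrespectralSpace.exists_isCompact_and_isOpen_between
    (hQ_closed.inter hv.isClosed_compl).isCompact hu
    (fun z hz ↦ (huv hz.1).resolve_right hz.2)
  obtain ⟨B, hBc, hBo, hQB, hBv⟩ := PrespectralSpace.exists_isCompact_and_isOpen_between
    (hQ_closed.inter hu.isClosed_compl).isCompact hv
    (fun z hz ↦ (huv hz.1).resolve_left hz.2)
  have hQAB : ∀ z ∈ Q, z ∈ A ∨ z ∈ B := fun z hz ↦ by
    by_cases hzv : z ∈ v
    · exact .inr (hQB ⟨hz, fun hzu ↦ hdis' z hz hzu hzv⟩)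
    · exact .inl (hQA ⟨hz, hzv⟩)
  have hK : IsCompact ((A ∪ B)ᶜ ∪ (A ∩ B)) :=
    (hAo.union hBo).isClosed_compl.isCompact.union
      (QuasiSeparatedSpace.inter_isCompact A B hAo hAc hBo hBc)
  obtain ⟨D, hD, hxD, hKD⟩ := hK.exists_isClopen_disjoint_of_disjoint_iInter x fun z hz ↦ by
    by_contra! hcon
    have hzQ := hQ_mem.2 hcon
    rcases hz with hz | hz
    · exact hz (hQAB z hzQ)
    · exact hdis' z hzQ (hAu hz.1) (hBv hz.2)
  rw [Set.disjoint_left] at hKD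
  have hDA : IsClopen (D ∩ A) := by
    refine ⟨⟨?_⟩, hD.isOpen.inter hAo⟩
    have : (D ∩ A)ᶜ = Dᶜ ∪ B := by
      ext z
      have := @hKD z
      grind
    rw [this]
    exact hD.compl.isOpen.union hBo
  have hDB : IsClopen (D ∩ B) := by
    refine ⟨⟨?_⟩, hD.isOpen.inter hBo⟩
    have : (D ∩ B)ᶜ = Dᶜ ∪ A := by
      ext z
      have := @hKD z
      grind
    rw [this]
    exact hD.compl.isOpen.union hAo
  rcases hQAB x hxQ with hx | hx
  · exact .inl fun z hz ↦ hAu (hQ_mem.1 hz _ hDA ⟨hxD, hx⟩).2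
  · exact .inr fun z hz ↦ hBv (hQ_mem.1 hz _ hDB ⟨hxD, hx⟩).2

lemma IsClopen.mem_of_connectedComponent_eq {Y : Type*} [TopologicalSpace Y] {D : Set Y}
    (hD : IsClopen D) {x y : Y} (hxy : connectedComponent x = connectedComponent y)
    (hx : x ∈ D) : y ∈ D :=
  hD.connectedComponent_subset hx (hxy ▸ mem_connectedComponent)

lemma PrespectralSpace.t2Space_connectedComponents : T2Space (ConnectedComponents X) := by
  refine ⟨ConnectedComponents.surjective_coe.forall₂.2 fun a b hab ↦ ?_⟩
  rw [ConnectedComponents.coe_ne_coe] at hab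
  obtain ⟨D, hD, ha, hb⟩ : ∃ D : Set X, IsClopen D ∧ a ∈ D ∧ b ∉ D := by
    by_contra! hcon
    exact hab (connectedComponent_eq (mem_connectedComponent_of_forall_isClopen hcon))
  have hpre : ((↑) : X → ConnectedComponents X) ⁻¹' ((↑) '' D) = D :=
    (connectedComponents_preimage_image D).trans hD.biUnion_connectedComponent_eq
  have himg : IsClopen (((↑) : X → ConnectedComponents X) '' D) := by
    rw [← ConnectedComponents.isQuotientMap_coe.isClopen_preimage, hpre]
    exact hD
  refine ⟨_, _, himg.isOpen, himg.compl.isOpen, ⟨a, ha, rfl⟩, fun hb' ↦ hb ?_,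
    disjoint_compl_right⟩
  rw [← hpre]
  exact hb'

/-- If every clopen subset of a dense compact open subset `U` extends to a clopen subset of the
ambient space, then the inclusion induces a homeomorphism on connected components. -/
theorem PrespectralSpace.exists_connectedComponents_homeomorph {U : Set X} (hUo : IsOpen U)
    (hUc : IsCompact U) (hUd : Dense U)
    (hext : ∀ Z : Set U, IsClopen Z → ∃ D : Set X, IsClopen D ∧ Subtype.val ⁻¹' D = Z) :
    ∃ Φ : ConnectedComponents U ≃ₜ ConnectedComponents X,
      ∀ x : U, Φ (ConnectedComponents.mk x) = ConnectedComponents.mk x.1 := by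
  have : CompactSpace U := isCompact_iff_compactSpace.1 hUc
  have : PrespectralSpace U := hUo.isOpenEmbedding_subtypeVal.prespectralSpace
  have : QuasiSeparatedSpace U := .of_isOpenEmbedding hUo.isOpenEmbedding_subtypeVal
  have : T2Space (ConnectedComponents X) := PrespectralSpace.t2Space_connectedComponents
  let f : ConnectedComponents U → ConnectedComponents X :=
    (continuous_subtype_val (p := (· ∈ U))).connectedComponentsMap
  have hf : Continuous f := continuous_subtype_val.connectedComponentsMap_continuous
  have hmk (x : U) : f (ConnectedComponents.mk x) = ConnectedComponents.mk x.1 := rfl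
  have hinj : Function.Injective f := by
    refine ConnectedComponents.surjective_coe.forall₂.2 fun a b hab ↦ ?_
    replace hab : connectedComponent a.1 = connectedComponent b.1 :=
      ConnectedComponents.coe_eq_coe.1 hab
    refine ConnectedComponents.coe_eq_coe.2 (connectedComponent_eq
      (mem_connectedComponent_of_forall_isClopen fun Z hZ ha ↦ ?_))
    obtain ⟨D, hD, rfl⟩ := hext Z hZ
    exact hD.mem_of_connectedComponent_eq hab ha
  have hsurj : Function.Surjective f := by
    refine ConnectedComponents.surjective_coe.forall.2 fun x ↦ ?_
    by_contra! hcon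
    obtain ⟨D, hD, hxD, hUD⟩ := hUc.exists_isClopen_disjoint_of_disjoint_iInter x fun y hy ↦ by
      by_contra! hxy
      exact hcon (ConnectedComponents.mk ⟨y, hy⟩) ((hmk _).trans (ConnectedComponents.coe_eq_coe.2
        (connectedComponent_eq (mem_connectedComponent_of_forall_isClopen hxy)).symm))
    obtain ⟨y, hyD, hyU⟩ := hUd.inter_open_nonempty D hD.isOpen ⟨x, hxD⟩
    exact Set.disjoint_left.1 hUD hyU hyD
  exact ⟨hf.homeoOfEquivCompactToT2 (f := Equiv.ofBijective f ⟨hinj, hsurj⟩), hmk⟩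

end QuasiComponents

section Constructible

lemma IsCompact.of_topology_le {X : Type*} {t t' : TopologicalSpace X} (h : t ≤ t') {s : Set X}
    (hs : @IsCompact X t s) : @IsCompact X t' s := by
  simpa using @IsCompact.image X X t t' s id hs (continuous_id_iff_le.2 h)

variable {X Y : Type*} [TopologicalSpace X] [TopologicalSpace Y]

lemma constructibleTopology_le [hX : PrespectralSpace X] :
    constructibleTopology X ≤ ‹TopologicalSpace X› := by
  conv_rhs => rw [hX.isTopologicalBasis.eq_generateFrom]
  exact generateFrom_anti Set.subset_union_left

lemma t2Space_constructibleTopology [PrespectralSpace X] [T0Space X] :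
    @T2Space X (constructibleTopology X) := by
  have key (x y : X) (O : Set X) (hO : IsOpen O) (hx : x ∈ O) (hy : y ∉ O) :
      ∃ V : Set X, IsOpen[constructibleTopology X] V ∧ IsOpen[constructibleTopology X] Vᶜ ∧
        x ∈ V ∧ y ∉ V := by
    obtain ⟨V, ⟨hVo, hVc⟩, hxV, hVO⟩ :=
      PrespectralSpace.isTopologicalBasis.exists_subset_of_mem_open hx hO
    exact ⟨V, hVc.isOpen_constructibleTopology_of_isOpen hVo,
      IsCompact.isOpen_constructibleTopology_of_isClosed (by rwa [compl_compl])
        hVo.isClosed_compl, hxV, fun h ↦ hy (hVO h)⟩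
  refine @T2Space.mk X (constructibleTopology X) fun x y hxy ↦ ?_
  obtain ⟨O, hO, h | h⟩ := exists_isOpen_xor_mem hxy
  · obtain ⟨V, hV, hV', hx, hy⟩ := key x y O hO h.1 h.2
    exact ⟨V, Vᶜ, hV, hV', hx, hy, disjoint_compl_right⟩
  · obtain ⟨V, hV, hV', hx, hy⟩ := key y x O hO h.1 h.2
    exact ⟨Vᶜ, V, hV', hV, hy, hx, disjoint_compl_left⟩

lemma compactSpace_constructibleTopology [CompactSpace X] [QuasiSober X] [PrespectralSpace X]
    [QuasiSeparatedSpace X] : @CompactSpace X (constructibleTopology X) :=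
  @Function.Surjective.compactSpace _ _ _ (constructibleTopology X) _
    (WithTopology.continuous_ofTopology _) inferInstance (WithTopology.ofTopology_surjective _)

lemma IsSpectralMap.continuous_constructibleTopology {f : X → Y} (hf : IsSpectralMap f) :
    @Continuous X Y (constructibleTopology X) (constructibleTopology Y) f := by
  refine continuous_generateFrom_iff.2 ?_
  rintro s (⟨hso, hsc⟩ | ⟨hsc, hscc⟩)
  · exact (hf.isCompact_preimage_of_isOpen hso hsc).isOpen_constructibleTopology_of_isOpen
      (hso.preimage hf.continuous)
  · exact IsCompact.isOpen_constructibleTopology_of_isClosed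
      (hf.isCompact_preimage_of_isOpen hsc.isOpen_compl hscc) (hsc.preimage hf.continuous)

end Constructible

section InverseLimit

variable {I : Type*} [PartialOrder I] {S : I → Type*}

/-- The inverse limit of a system of types, as a subtype of the product. -/
abbrev InverseLimit (S : I → Type*) (p : ∀ {i j : I}, j ≤ i → S i → S j) : Type _ :=
  {x : ∀ i, S i // ∀ (i j : I) (h : j ≤ i), p h (x i) = x j}

variable {p : ∀ {i j : I}, j ≤ i → S i → S j}

namespace InverseLimit

lemma map_apply (x : InverseLimit S p) {i j : I} (h : j ≤ i) : p h (x.1 i) = x.1 j :=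
  x.2 i j h

variable [∀ i, TopologicalSpace (S i)]

lemma isClosed_setOf_compatible [∀ i, T2Space (S i)]
    (hcont : ∀ (i j : I) (h : j ≤ i), Continuous (p h)) :
    IsClosed {x : ∀ i, S i | ∀ (i j : I) (h : j ≤ i), p h (x i) = x j} := by
  simp only [Set.ofPred_forall]
  exact isClosed_iInter fun i ↦ isClosed_iInter fun j ↦ isClosed_iInter fun h ↦
    isClosed_eq ((hcont i j h).comp (continuous_apply i)) (continuous_apply j)

lemma isCompact_preimage_proj_of_t2Space [∀ i, T2Space (S i)] [∀ i, CompactSpace (S i)]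
    (hcont : ∀ (i j : I) (h : j ≤ i), Continuous (p h)) {i : I} {V : Set (S i)}
    (hV : IsClosed V) : IsCompact ((fun x : InverseLimit S p ↦ x.1 i) ⁻¹' V) :=
  have : CompactSpace (InverseLimit S p) :=
    isCompact_iff_compactSpace.1 (isClosed_setOf_compatible hcont).isCompact
  (hV.preimage ((continuous_apply i).comp continuous_subtype_val)).isCompact

lemma surjective_proj_of_t2Space [IsDirected I (· ≤ ·)] [∀ i, T2Space (S i)]
    [∀ i, CompactSpace (S i)]
    (hp_comp : ∀ {i j k : I} (hij : j ≤ i) (hjk : k ≤ j) (x : S i),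
      p hjk (p hij x) = p (hjk.trans hij) x)
    (hcont : ∀ (i j : I) (h : j ≤ i), Continuous (p h))
    (hsurj : ∀ (i j : I) (h : j ≤ i), Function.Surjective (p h)) (j : I) :
    Function.Surjective fun x : InverseLimit S p ↦ x.1 j := by
  classical
  intro y
  have hne (l : I) : Nonempty (S l) := by
    obtain ⟨m, hjm, hlm⟩ := exists_ge_ge j l
    obtain ⟨z, -⟩ := hsurj m j hjm y
    exact ⟨p hlm z⟩
  let T (k : {k : I // j ≤ k}) : Set (∀ i, S i) :=
    {x | p k.2 (x k) = y ∧ ∀ (l : I) (h : l ≤ k), p h (x k) = x l}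
  have hT_closed (k) : IsClosed (T k) := by
    simp only [T, Set.ofPred_and, Set.ofPred_forall]
    exact (isClosed_eq ((hcont _ _ _).comp (continuous_apply _)) continuous_const).inter
      (isClosed_iInter fun l ↦ isClosed_iInter fun h ↦
        isClosed_eq ((hcont _ _ _).comp (continuous_apply _)) (continuous_apply _))
  have hT_mono (k k' : {k : I // j ≤ k}) (h : k.1 ≤ k'.1) : T k' ⊆ T k := by
    intro x hx
    have hk := hx.2 k.1 h
    refine ⟨?_, fun l hl ↦ ?_⟩
    · rw [← hk, hp_comp]
      exact hx.1
    · rw [← hk, hp_comp]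
      exact hx.2 l _
  have hT_nonempty (k) : (T k).Nonempty := by
    obtain ⟨z, hz⟩ := hsurj k.1 j k.2 y
    obtain ⟨w, hw⟩ := hsurj k.1 k.1 le_rfl z
    refine ⟨fun l ↦ if h : l ≤ k.1 then p h w else (hne l).some, ?_, fun l h ↦ ?_⟩
    · simp only [le_refl, dif_pos]
      rw [hw, hz]
    · simp only [le_refl, dif_pos, h]
      rw [hp_comp]
  have : Nonempty {k : I // j ≤ k} := ⟨⟨j, le_rfl⟩⟩
  obtain ⟨x, hx⟩ := IsCompact.nonempty_iInter_of_directed_nonempty_isCompact_isClosed T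
    (fun k k' ↦ by
      obtain ⟨m, hkm, hkm'⟩ := exists_ge_ge k.1 k'.1
      exact ⟨⟨m, k.2.trans hkm⟩, hT_mono _ _ hkm, hT_mono _ _ hkm'⟩)
    hT_nonempty (fun k ↦ (hT_closed k).isCompact) hT_closed
  rw [Set.mem_iInter] at hx
  refine ⟨⟨x, fun i l h ↦ ?_⟩, ?_⟩
  · obtain ⟨m, hjm, him⟩ := exists_ge_ge j i
    have hm := (hx ⟨m, hjm⟩).2
    change p h (x i) = x l
    rw [← hm i him, ← hm l (h.trans him), hp_comp]
  · have hj := hx ⟨j, le_rfl⟩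
    exact (hj.2 j le_rfl).symm.trans hj.1

variable [∀ i, PrespectralSpace (S i)]

/-- Compact opens pulled back from the stages are cofinal among the open neighbourhoods of a
compact subset of an inverse limit. -/
lemma exists_isCompact_isOpen_between [IsDirected I (· ≤ ·)] [Nonempty I]
    (hspec : ∀ (i j : I) (h : j ≤ i), IsSpectralMap (p h))
    {K O : Set (InverseLimit S p)} (hK : IsCompact K) (hO : IsOpen O) (hKO : K ⊆ O) :
    ∃ (i : I) (V : Set (S i)), IsOpen V ∧ IsCompact V ∧ K ⊆ (fun x ↦ x.1 i) ⁻¹' V ∧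
      (fun x : InverseLimit S p ↦ x.1 i) ⁻¹' V ⊆ O := by
  refine hK.induction_on (p := fun K ↦ ∃ (i : I) (V : Set (S i)), IsOpen V ∧ IsCompact V ∧
    K ⊆ (fun x ↦ x.1 i) ⁻¹' V ∧ (fun x : InverseLimit S p ↦ x.1 i) ⁻¹' V ⊆ O) ?_ ?_ ?_ ?_
  · exact ⟨Classical.arbitrary I, ∅, by simp⟩
  · rintro s t hst ⟨i, V, hVo, hVc, htV, hVO⟩
    exact ⟨i, V, hVo, hVc, hst.trans htV, hVO⟩
  · rintro s t ⟨i, V, hVo, hVc, hsV, hVO⟩ ⟨j, W, hWo, hWc, htW, hWO⟩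
    obtain ⟨k, hik, hjk⟩ := exists_ge_ge i j
    have hV (x : InverseLimit S p) : p hik (x.1 k) ∈ V ↔ x.1 i ∈ V := by rw [map_apply (p := p) x]
    have hW (x : InverseLimit S p) : p hjk (x.1 k) ∈ W ↔ x.1 j ∈ W := by rw [map_apply (p := p) x]
    refine ⟨k, p hik ⁻¹' V ∪ p hjk ⁻¹' W,
      (hVo.preimage (hspec _ _ _).continuous).union (hWo.preimage (hspec _ _ _).continuous),
      ((hspec _ _ _).isCompact_preimage_of_isOpen hVo hVc).union
        ((hspec _ _ _).isCompact_preimage_of_isOpen hWo hWc), ?_, ?_⟩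
    · rintro x (hx | hx)
      · exact .inl ((hV x).2 (hsV hx))
      · exact .inr ((hW x).2 (htW hx))
    · rintro x (hx | hx)
      · exact hVO ((hV x).1 hx)
      · exact hWO ((hW x).1 hx)
  · intro x hxK
    obtain ⟨O', hO', rfl⟩ := isOpen_induced_iff.1 hO
    obtain ⟨F, u, hu, hF⟩ := isOpen_pi_iff.1 hO' x.1 (hKO hxK)
    obtain ⟨k, hk⟩ := F.exists_le
    have hopen : IsOpen (⋂ i : F, p (hk i.1 i.2) ⁻¹' u i.1) :=
      isOpen_iInter_of_finite fun i ↦ (hu i.1 i.2).1.preimage (hspec _ _ _).continuous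
    have hxk : x.1 k ∈ ⋂ i : F, p (hk i.1 i.2) ⁻¹' u i.1 := by
      refine Set.mem_iInter.2 fun i ↦ ?_
      rw [Set.mem_preimage, map_apply (p := p) x]
      exact (hu i.1 i.2).2
    obtain ⟨V, ⟨hVo, hVc⟩, hxV, hVu⟩ :=
      PrespectralSpace.isTopologicalBasis.exists_subset_of_mem_open hxk hopen
    refine ⟨(fun x ↦ x.1 k) ⁻¹' V, mem_nhdsWithin_of_mem_nhds ((hVo.preimage
      ((continuous_apply k).comp continuous_subtype_val)).mem_nhds hxV), k, V, hVo, hVc,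
      subset_rfl, fun y hy ↦ hF fun i hi ↦ ?_⟩
    have hyi : p (hk i hi) (y.1 k) ∈ u i := Set.mem_iInter.1 (hVu hy) ⟨i, hi⟩
    rwa [map_apply (p := p) y] at hyi

/-- Two compact opens of an inverse limit are pulled back from compact opens of a common stage. -/
lemma exists_eq_preimage_pair [IsDirected I (· ≤ ·)] [Nonempty I]
    (hspec : ∀ (i j : I) (h : j ≤ i), IsSpectralMap (p h))
    {A B : Set (InverseLimit S p)} (hAo : IsOpen A) (hAc : IsCompact A) (hBo : IsOpen B)
    (hBc : IsCompact B) :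
    ∃ (k : I) (V W : Set (S k)), IsOpen V ∧ IsCompact V ∧ IsOpen W ∧ IsCompact W ∧
      (fun x ↦ x.1 k) ⁻¹' V = A ∧ (fun x ↦ x.1 k) ⁻¹' W = B := by
  obtain ⟨i, V, hVo, hVc, hAV, hVA⟩ := exists_isCompact_isOpen_between hspec hAc hAo subset_rfl
  obtain ⟨j, W, hWo, hWc, hBW, hWB⟩ := exists_isCompact_isOpen_between hspec hBc hBo subset_rfl
  obtain ⟨k, hik, hjk⟩ := exists_ge_ge i j
  refine ⟨k, p hik ⁻¹' V, p hjk ⁻¹' W, hVo.preimage (hspec _ _ _).continuous,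
    (hspec _ _ _).isCompact_preimage_of_isOpen hVo hVc, hWo.preimage (hspec _ _ _).continuous,
    (hspec _ _ _).isCompact_preimage_of_isOpen hWo hWc, ?_, ?_⟩
  · refine Eq.trans ?_ (subset_antisymm hVA hAV)
    ext x
    simp only [Set.mem_preimage, map_apply]
  · refine Eq.trans ?_ (subset_antisymm hWB hBW)
    ext x
    simp only [Set.mem_preimage, map_apply]

/-- If every stage is a finite disjoint union of irreducible opens, clopen subsets of a compact
open subset of the limit extend to clopen subsets of the limit. -/
lemma exists_isClopen_extension [IsDirected I (· ≤ ·)] [Nonempty I]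
    (hspec : ∀ (i j : I) (h : j ≤ i), IsSpectralMap (p h))
    (hproj : ∀ j, Function.Surjective fun x : InverseLimit S p ↦ x.1 j)
    (hirr : ∀ i : I, ∃ (n : ℕ) (V : Fin n → Set (S i)),
      (∀ k, IsOpen (V k)) ∧ (∀ k, IsIrreducible (V k)) ∧
      Pairwise (Function.onFun Disjoint V) ∧ (⋃ k, V k) = Set.univ)
    {U : Set (InverseLimit S p)} (hUo : IsOpen U) (hUc : IsCompact U) (Z : Set U)
    (hZ : IsClopen Z) : ∃ D : Set (InverseLimit S p), IsClopen D ∧ Subtype.val ⁻¹' D = Z := by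
  have : CompactSpace U := isCompact_iff_compactSpace.1 hUc
  have himg {Z : Set U} (hZ : IsClopen Z) :
      IsOpen (Subtype.val '' Z) ∧ IsCompact (Subtype.val '' Z) :=
    ⟨hUo.isOpenMap_subtype_val _ hZ.isOpen, hZ.isClosed.isCompact.image continuous_subtype_val⟩
  obtain ⟨j, W, W', hWo, -, hWo', -, hW, hW'⟩ := exists_eq_preimage_pair hspec
    (himg hZ).1 (himg hZ).2 (himg hZ.compl).1 (himg hZ.compl).2
  have hWZ (x : U) : x.1.1 j ∈ W ↔ x ∈ Z := by
    rw [← Subtype.val_injective.mem_set_image (s := Z), ← hW, Set.mem_preimage]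
  have hWZ' (x : U) : x.1.1 j ∈ W' ↔ x ∉ Z := by
    rw [← Set.mem_compl_iff, ← Subtype.val_injective.mem_set_image (s := Zᶜ), ← hW',
      Set.mem_preimage]
  have hdis (y : S j) (hy : y ∈ W) (hy' : y ∈ W') : False := by
    obtain ⟨x, rfl⟩ := hproj j y
    obtain ⟨z, hz, rfl⟩ := (hW ▸ hy : x ∈ Subtype.val '' Z)
    exact (hWZ' z).1 hy' hz
  obtain ⟨n, V, hVo, hVi, hVd, hVu⟩ := hirr j
  let D : Set (S j) := ⋃ (k) (_ : (V k ∩ W).Nonempty), V k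
  have hcover (y : S j) : ∃ k, y ∈ V k := Set.mem_iUnion.1 (hVu ▸ Set.mem_univ y)
  have hD : IsClopen D := by
    refine ⟨⟨?_⟩, isOpen_biUnion fun k _ ↦ hVo k⟩
    have : Dᶜ = ⋃ (k) (_ : ¬ (V k ∩ W).Nonempty), V k := by
      ext y
      simp only [D, Set.mem_compl_iff, Set.mem_iUnion, exists_prop, not_exists, not_and]
      refine ⟨fun h ↦ ?_, ?_⟩
      · obtain ⟨k, hk⟩ := hcover y
        exact ⟨k, fun hne ↦ h k hne hk, hk⟩
      · rintro ⟨k, hk, hyk⟩ l hl hyl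
        obtain rfl : k = l := by
          by_contra hkl
          exact Set.disjoint_left.1 (hVd hkl) hyk hyl
        exact hk hl
    rw [this]
    exact isOpen_biUnion fun k _ ↦ hVo k
  refine ⟨(fun x ↦ x.1 j) ⁻¹' D,
    hD.preimage ((continuous_apply j).comp continuous_subtype_val), ?_⟩
  ext x
  simp only [D, Set.mem_preimage, Set.mem_iUnion, exists_prop]
  refine ⟨?_, fun hx ↦ ?_⟩
  · rintro ⟨k, hk, hxk⟩
    by_contra hx
    obtain ⟨y, -, hy, hy'⟩ := (hVi k).isPreirreducible W W' hWo hWo' hk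
      ⟨_, hxk, (hWZ' x).2 hx⟩
    exact hdis y hy hy'
  · obtain ⟨k, hk⟩ := hcover (x.1.1 j)
    exact ⟨k, ⟨_, hk, (hWZ x).2 hx⟩, hk⟩

variable [∀ i, QuasiSober (S i)] [∀ i, CompactSpace (S i)] [∀ i, QuasiSeparatedSpace (S i)]
  [∀ i, T0Space (S i)]

lemma surjective_proj [IsDirected I (· ≤ ·)]
    (hp_comp : ∀ {i j k : I} (hij : j ≤ i) (hjk : k ≤ j) (x : S i),
      p hjk (p hij x) = p (hjk.trans hij) x)
    (hspec : ∀ (i j : I) (h : j ≤ i), IsSpectralMap (p h))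
    (hsurj : ∀ (i j : I) (h : j ≤ i), Function.Surjective (p h)) (j : I) :
    Function.Surjective fun x : InverseLimit S p ↦ x.1 j :=
  @surjective_proj_of_t2Space I _ S p (fun i ↦ constructibleTopology (S i)) _
    (fun _ ↦ t2Space_constructibleTopology) (fun _ ↦ compactSpace_constructibleTopology) hp_comp
    (fun i j h ↦ (hspec i j h).continuous_constructibleTopology) hsurj j

lemma isCompact_preimage_proj (hspec : ∀ (i j : I) (h : j ≤ i), IsSpectralMap (p h)) {i : I}
    {V : Set (S i)} (hVo : IsOpen V) (hVc : IsCompact V) :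
    IsCompact ((fun x : InverseLimit S p ↦ x.1 i) ⁻¹' V) := by
  have hVclosed : IsClosed[constructibleTopology (S i)] V :=
    @IsClosed.mk _ (constructibleTopology (S i)) _
      (IsCompact.isOpen_constructibleTopology_of_isClosed (by rwa [compl_compl])
        hVo.isClosed_compl)
  have hle (i : I) : constructibleTopology (S i) ≤ ‹∀ i, TopologicalSpace (S i)› i :=
    constructibleTopology_le
  exact IsCompact.of_topology_le
    (induced_mono (iInf_mono fun i ↦ induced_mono (hle i)))
    (@isCompact_preimage_proj_of_t2Space I _ S p (fun i ↦ constructibleTopology (S i))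
      (fun _ ↦ t2Space_constructibleTopology) (fun _ ↦ compactSpace_constructibleTopology)
      (fun i j h ↦ (hspec i j h).continuous_constructibleTopology) i V hVclosed)

lemma compactSpace [Nonempty I] (hspec : ∀ (i j : I) (h : j ≤ i), IsSpectralMap (p h)) :
    CompactSpace (InverseLimit S p) :=
  ⟨isCompact_preimage_proj hspec (i := Classical.arbitrary I) isOpen_univ isCompact_univ⟩

lemma prespectralSpace [IsDirected I (· ≤ ·)] [Nonempty I]
    (hspec : ∀ (i j : I) (h : j ≤ i), IsSpectralMap (p h)) :
    PrespectralSpace (InverseLimit S p) := by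
  refine ⟨isTopologicalBasis_of_isOpen_of_nhds (fun _ h ↦ h.1) fun x O hx hO ↦ ?_⟩
  obtain ⟨i, V, hVo, hVc, hxV, hVO⟩ := exists_isCompact_isOpen_between hspec
    (isCompact_singleton (x := x)) hO (Set.singleton_subset_iff.2 hx)
  exact ⟨_, ⟨hVo.preimage ((continuous_apply i).comp continuous_subtype_val),
    isCompact_preimage_proj hspec hVo hVc⟩, Set.singleton_subset_iff.1 hxV, hVO⟩

lemma quasiSeparatedSpace [IsDirected I (· ≤ ·)] [Nonempty I]
    (hspec : ∀ (i j : I) (h : j ≤ i), IsSpectralMap (p h)) :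
    QuasiSeparatedSpace (InverseLimit S p) := by
  refine ⟨fun A B hAo hAc hBo hBc ↦ ?_⟩
  obtain ⟨k, V, W, hVo, hVc, hWo, hWc, rfl, rfl⟩ :=
    exists_eq_preimage_pair hspec hAo hAc hBo hBc
  exact isCompact_preimage_proj hspec (hVo.inter hWo)
    (QuasiSeparatedSpace.inter_isCompact V W hVo hVc hWo hWc)

end InverseLimit

end InverseLimit

/-- Let `{S i}` be an inverse system of spectral spaces over a directed
partially ordered set, with quasi-compact surjective continuous transition maps, and let
`S = lim_i S i`.  Suppose each `S i` is a disjoint union of finitely many irreducible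
spaces (a finite partition into pairwise disjoint open irreducible subspaces).  Then for
every dense quasi-compact open `U ⊆ S`, the natural map `π₀(U) → π₀(S)` induced by the
inclusion is a homeomorphism. -/
theorem stmt_9 {I : Type*} [PartialOrder I] [IsDirected I (· ≤ ·)]
    (S : I → Type*) [∀ i, TopologicalSpace (S i)]
    (p : ∀ {i j : I}, j ≤ i → S i → S j)
    (hp_id : ∀ (i : I) (x : S i), p (le_refl i) x = x)
    (hp_comp : ∀ {i j k : I} (hij : j ≤ i) (hjk : k ≤ j) (x : S i),
      p hjk (p hij x) = p (hjk.trans hij) x)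
    (hcont : ∀ (i j : I) (h : j ≤ i), Continuous (p h))
    (hspectral : ∀ i : I, IsSpectralSpace (S i))
    (hqc : ∀ (i j : I) (h : j ≤ i) (U : Set (S j)), IsOpen U → IsCompact U →
      IsCompact (p h ⁻¹' U))
    (hsurj : ∀ (i j : I) (h : j ≤ i), Function.Surjective (p h))
    -- each `S i` is a finite disjoint union of irreducible open subspaces
    (hirr : ∀ i : I, ∃ (n : ℕ) (V : Fin n → Set (S i)),
      (∀ k, IsOpen (V k)) ∧ (∀ k, IsIrreducible (V k)) ∧
      Pairwise (Function.onFun Disjoint V) ∧ (⋃ k, V k) = Set.univ)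
    (U : Set {x : ∀ i, S i // ∀ (i j : I) (h : j ≤ i), p h (x i) = x j})
    (hUopen : IsOpen U) (hUcomp : IsCompact U) (hUdense : Dense U) :
    ∃ Φ : ConnectedComponents U ≃ₜ ConnectedComponents
        {x : ∀ i, S i // ∀ (i j : I) (h : j ≤ i), p h (x i) = x j},
      ∀ x : U, Φ (ConnectedComponents.mk x) = ConnectedComponents.mk x.1 := by
  have (i : I) : CompactSpace (S i) := (hspectral i).1
  have (i : I) : T0Space (S i) := (hspectral i).2.1
  have (i : I) : QuasiSober (S i) := (hspectral i).2.2.1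
  have (i : I) : QuasiSeparatedSpace (S i) :=
    ⟨fun A B hAo hAc hBo hBc ↦ (hspectral i).2.2.2.1 A B hAo hAc hBo hBc⟩
  have (i : I) : PrespectralSpace (S i) := ⟨(hspectral i).2.2.2.2⟩
  have hspec (i j : I) (h : j ≤ i) : IsSpectralMap (p h) := ⟨hcont i j h, fun _ ↦ hqc i j h _⟩
  rcases isEmpty_or_nonempty I with hI | hI
  · refine PrespectralSpace.exists_connectedComponents_homeomorph hUopen hUcomp hUdense
      fun Z _ ↦ ⟨Subtype.val '' Z, isClopen_discrete _,
        Set.preimage_image_eq _ Subtype.val_injective⟩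
  · have : CompactSpace (InverseLimit S p) := InverseLimit.compactSpace hspec
    have : PrespectralSpace (InverseLimit S p) := InverseLimit.prespectralSpace hspec
    have : QuasiSeparatedSpace (InverseLimit S p) := InverseLimit.quasiSeparatedSpace hspec
    exact PrespectralSpace.exists_connectedComponents_homeomorph hUopen hUcomp hUdense
      (InverseLimit.exists_isClopen_extension hspec
        (InverseLimit.surjective_proj hp_comp hspec hsurj) hirr hUopen hUcomp)
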